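/- For all non-negative integers a, b with 2a + b = 68, the system L_3(14; 4^{×a}, 3^{×b}) is non-special of virtual dimension −1; that is, there exist a + b pairwise linearly independent points in ℚ^4 \ {0} such that the only homogeneous polynomial of degree 14 in 4 variables over ℚ vanishing to order ≥ 4 at the first a points and ≥ 3 at the remaining b points is the zero polynomial, and indeed C(17,3) − 20a − 10b − 1 = 680 − 10(2a+b) − 1 = −1. -/

import Mathlib

open MvPolynomial

/-- The differential operator `∂₀^{ν 0} ∂₁^{ν 1} ∂₂^{ν 2} ∂₃^{ν 3}` on polynomials
in 4 variables over `ℚ`. -/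
noncomputable def diffOp (ν : Fin 4 → ℕ) :
    Module.End ℚ (MvPolynomial (Fin 4) ℚ) :=
  ((pderiv (0 : Fin 4)).toLinearMap ^ ν 0) * ((pderiv (1 : Fin 4)).toLinearMap ^ ν 1) *
    ((pderiv (2 : Fin 4)).toLinearMap ^ ν 2) * ((pderiv (3 : Fin 4)).toLinearMap ^ ν 3)

/-- Polynomials all of whose partial derivatives of order `< m` (including order 0)
vanish at the point `pt : ℚ⁴`. -/
noncomputable def vanishingSpace (m : ℕ) (pt : Fin 4 → ℚ) :
    Submodule ℚ (MvPolynomial (Fin 4) ℚ) :=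
  ⨅ (ν : Fin 4 → ℕ) (_ : ∑ j, ν j < m),
    LinearMap.ker ((aeval pt).toLinearMap ∘ₗ
      (diffOp ν : MvPolynomial (Fin 4) ℚ →ₗ[ℚ] MvPolynomial (Fin 4) ℚ))

/-- `V(d; m_1,…,m_r; p_1,…,p_r)`: homogeneous polynomials of degree `d` in 4 variables
over `ℚ` vanishing to order `≥ ms[i]` at `pts i` for each `i`. -/
noncomputable def systemSpace (d : ℕ) (ms : List ℕ) (pts : Fin ms.length → Fin 4 → ℚ) :
    Submodule ℚ (MvPolynomial (Fin 4) ℚ) :=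
  homogeneousSubmodule (Fin 4) ℚ d ⊓ ⨅ i, vanishingSpace (ms.get i) (pts i)

/-- The virtual dimension `vdim L_3(d; m_1,…,m_r) = C(d+3,3) − Σ C(m_i+2,3) − 1`. -/
def vdim (d : ℕ) (ms : List ℕ) : ℤ :=
  ((d + 3).choose 3 : ℤ) - (ms.map fun m => ((m + 2).choose 3 : ℤ)).sum - 1

/-- The linear system `L_3(d; m_1,…,m_r)` is non-special: there exist pairwise linearly
independent points of `ℚ⁴ \ {0}` at which the space of degree-`d` homogeneous polynomials
with the prescribed multiplicities has dimension `max (vdim + 1) 0`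
(the expected dimension). -/
noncomputable def nonSpecial (d : ℕ) (ms : List ℕ) : Prop :=
  ∃ pts : Fin ms.length → Fin 4 → ℚ,
    (∀ i, pts i ≠ 0) ∧
    (∀ i j, i ≠ j → LinearIndependent ℚ ![pts i, pts j]) ∧
    (Module.finrank ℚ (systemSpace d ms pts) : ℤ) = max (vdim d ms + 1) 0

/-- The cells of the subdivision: weights, and the list of monomials. -/
def cells : List (ℕ × ℕ × ℕ × ℕ × List ℕ) := [
    (108749733511720, 5607022850, 67418560, 29537114358740, [513, 64, 289, 529, 754, 979, 994,
    65, 290, 80, 305, 530, 755, 320, 545, 770, 66, 291, 81, 306, 531, 756, 96, 321, 546, 336,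
    67, 82, 307, 532, 97, 322, 112, 68, 83, 308, 98, 69, 84, 70]),
    (108749733475025, 5607175000, 67286100, 29537114432130, [61, 47, 62, 287, 77, 302, 92, 63,
    288, 78, 303, 528, 753, 93, 318, 543, 108, 333, 79, 304, 94, 319, 544, 769, 109, 334, 559,
    784, 124, 349, 139, 95, 110, 335, 560, 125, 350, 140, 111, 126]),
    (108749885403960, 5735405230, 23270, 29537050321490, [90, 105, 120, 345, 135, 360, 585,
    150, 375, 600, 165, 390, 615, 840, 405, 630, 76, 91, 316, 106, 331, 556, 121, 346, 571,
    361, 586, 811, 601, 826, 616, 317, 542, 557, 782, 572, 797, 812, 768, 1008]),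
    (108749885669775, 5735339000, 0, 29537050350130, [180, 195, 420, 210, 136, 151, 376, 166,
    391, 181, 406, 196, 107, 332, 122, 347, 137, 362, 587, 152, 377, 602, 167, 392, 182, 558,
    783, 123, 348, 573, 798, 138, 363, 588, 153, 378, 168, 574, 364, 154]),
    (108615220838170, 64223410, 48886625560, 29515485287540, [18, 33, 258, 273, 4, 229, 19,
    244, 34, 259, 484, 499, 5, 230, 455, 20, 245, 470, 35, 260, 485, 710, 725, 6, 231, 456,
    681, 21, 246, 471, 261, 486, 7, 232, 457, 22, 247, 8, 233, 9]),
    (108615222152925, 64082000, 48886555750, 29515485155080, [950, 696, 921, 711, 936, 951,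
    1176, 682, 907, 472, 697, 922, 1147, 712, 937, 1162, 458, 683, 908, 1133, 248, 473, 698,
    923, 1148, 938, 234, 459, 684, 909, 1134, 474, 699, 924, 235, 460, 685, 910, 461, 686]),
    (108615821560380, 78760, 48750309900, 29515542896900, [48, 49, 274, 514, 739, 50, 275, 500,
    515, 740, 965, 980, 36, 51, 276, 501, 726, 516, 741, 966, 37, 262, 487, 52, 277, 502, 727,
    292, 517, 742, 23, 38, 263, 53, 278, 503, 293, 518, 54, 294]),
    (108615822120650, 0, 48750381500, 29515542828880, [952, 488, 713, 728, 24, 249, 39, 264,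
    489, 714, 279, 504, 10, 25, 250, 475, 700, 40, 265, 490, 55, 280, 11, 236, 26, 251, 476,
    41, 266, 56, 12, 237, 462, 27, 252, 42, 13, 238, 28, 14]),
    (0, 34697359070990, 19232080007250, 56103878710, [0, 225, 450, 675, 15, 240, 465, 30, 255,
    45, 270, 60, 1, 226, 451, 16, 241, 466, 691, 31, 256, 481, 46, 271, 286, 2, 227, 17, 242,
    467, 32, 257, 482, 272, 497, 3, 243, 483, 498, 724]),
    (174525, 34697359105000, 19232079971450, 56103821430, [690, 915, 480, 705, 930, 495, 720,
    945, 285, 510, 735, 75, 300, 525, 750, 315, 540, 330, 555, 706, 931, 496, 721, 946, 511,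
    736, 301, 526, 751, 541, 707, 722, 947, 512, 737, 527, 752, 723, 948, 738]),
    (689311100, 34697367032910, 19232025353180, 55974198580, [765, 990, 780, 1005, 1230, 570,
    795, 1020, 1245, 1470, 810, 1035, 1260, 825, 1050, 766, 991, 1216, 781, 1006, 1231, 1456,
    796, 1021, 1246, 1036, 977, 767, 992, 1217, 1007, 1232, 1022, 963, 978, 1203, 993, 1218,
    964, 1204]),
    (689056025, 34697367115250, 19232025501750, 55974055380, [1155, 1170, 1395, 960, 1185,
    1410, 1635, 975, 1200, 1425, 1650, 1875, 2100, 1215, 1440, 1665, 1890, 1455, 1680, 1171,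
    961, 1186, 1411, 1636, 976, 1201, 1426, 1651, 1876, 1441, 1666, 962, 1187, 1412, 1202,
    1427, 1652, 1442, 1188, 1428]),
    (178940519195, 34648685573570, 19297850600170, 0, [2025, 2250, 2475, 2700, 2925, 3150,
    1815, 2040, 2265, 2490, 2715, 2940, 2505, 2730, 2251, 2476, 2701, 2926, 1816, 2041, 2266,
    2491, 2716, 2056, 2281, 2506, 2477, 2702, 2042, 2267, 2492, 1607, 1832, 2057, 2282, 2268,
    1833, 2058, 1848, 1624]),
    (178940348250, 34648685621900, 19297850532150, 30430, [1365, 1590, 1380, 1605, 1830, 2055,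
    2280, 1620, 1845, 2070, 2295, 2520, 1860, 2085, 2310, 1156, 1381, 1606, 1831, 1396, 1621,
    1846, 2071, 2296, 1861, 2086, 1172, 1397, 1622, 1847, 2072, 1637, 1862, 1173, 1398, 1623,
    1413, 1638, 1189, 1414]),
    (178485084125, 34648616676470, 19297981894880, 54457170, [2252, 2028, 2253, 2478, 1818,
    2043, 1579, 1804, 2029, 2254, 1594, 1819, 2044, 1609, 1834, 1355, 1580, 1805, 2030, 1370,
    1595, 1820, 1385, 1610, 1400, 1190, 1131, 1356, 1581, 1806, 1146, 1371, 1596, 1161, 1386,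
    1132, 1357, 1582, 1372, 1358]),
    (178484565185, 34648616733776, 19297981900238, 54500084, [900, 1125, 1350, 1575, 1800,
    1140, 1126, 1351, 1576, 1801, 2026, 916, 1141, 1366, 1591, 1127, 1352, 1577, 1802, 2027,
    1142, 1367, 1592, 1817, 1157, 1382, 1353, 1578, 1803, 1143, 1368, 1593, 1158, 1383, 1608,
    1354, 1369, 1384, 1174, 1399]),
    (178484565025, 34648616733750, 19297981900250, 54500130, [676, 901, 452, 677, 902, 692,
    917, 932, 228, 453, 678, 903, 1128, 468, 693, 918, 708, 933, 454, 679, 904, 1129, 469, 694,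
    919, 1144, 709, 934, 1159, 949, 680, 905, 1130, 695, 920, 1145, 935, 1160, 1175, 906])]

/-- Monomials are coded as natural numbers `x + 15 y + 225 z`. -/
def cx (n : ℕ) : ℕ := Nat.mod n 15
def cy (n : ℕ) : ℕ := Nat.mod (Nat.div n 15) 15
def cz (n : ℕ) : ℕ := Nat.div n 225

/-- Evaluate a natural number before continuing (useful for kernel reduction). -/
def force {α : Type} (x : ℕ) (k : ℕ → α) : α :=
  Nat.rec (motive := fun _ => α) (k 0) (fun n _ => k (Nat.succ n)) x

/-- Slotwise partial reduction modulo `8191 = 2 ^ 13 - 1` of a vector packed in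
slots of `32` bits. -/
def fold (M M2 X : ℕ) : ℕ := Nat.add (Nat.land X M) (Nat.land (Nat.div X 8192) M2)

/-- Eliminate the head of all the rows with the pivot row `h :: r`. -/
def elimRows (M M2 h r : ℕ) (k : List ℕ → Bool) (rows : List ℕ) : List ℕ → Bool :=
  List.rec (motive := fun _ => List ℕ → Bool) (fun acc => k acc)
    (fun o _ ih acc =>
      force (fold M M2 (fold M M2 (Nat.add (Nat.mul h (Nat.div o 4294967296))
        (Nat.mul (Nat.sub 8191 (Nat.mod (Nat.mod o 4294967296) 8191)) r))))
        fun v => ih (List.cons v acc)) rows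

/-- Look for a pivot row; the rows with zero head are collected in `acc`. -/
def pivot (k : ℕ → ℕ → List ℕ → Bool) (rows : List ℕ) : List ℕ → Bool :=
  List.rec (motive := fun _ => List ℕ → Bool) (fun _ => false)
    (fun o rows ih acc =>
      Nat.rec (motive := fun _ => Bool) (ih (List.cons o acc))
        (fun h _ => k (Nat.succ h) (Nat.div o 4294967296) (acc ++ rows))
        (Nat.mod (Nat.mod o 4294967296) 8191)) rows

/-- Gaussian elimination modulo `8191` on packed rows. -/
def elim (n : ℕ) : ℕ → ℕ → List ℕ → Bool :=
  Nat.rec (motive := fun _ => ℕ → ℕ → List ℕ → Bool) (fun _ _ _ => true)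
    (fun _ ih M M2 rows =>
      force (Nat.div M 4294967296) fun M => force (Nat.div M2 4294967296) fun M2 =>
        pivot (fun h r rest => force r fun r =>
          elimRows M M2 h r (fun l => ih M M2 l) rest []) rows []) n

/-- The exponents of the differential operators of order `< 3`. -/
def nus3 : List (ℕ × ℕ × ℕ) :=
  [(0, 0, 0), (0, 0, 1), (0, 0, 2), (0, 1, 0), (0, 1, 1), (0, 2, 0), (1, 0, 0), (1, 0, 1),
    (1, 1, 0), (2, 0, 0)]

/-- The exponents of the differential operators of order `< 4`. -/
def nus4 : List (ℕ × ℕ × ℕ) :=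
  [(0, 0, 0), (0, 0, 1), (0, 0, 2), (0, 0, 3), (0, 1, 0), (0, 1, 1), (0, 1, 2), (0, 2, 0),
    (0, 2, 1), (0, 3, 0), (1, 0, 0), (1, 0, 1), (1, 0, 2), (1, 1, 0), (1, 1, 1), (1, 2,
    0), (2, 0, 0), (2, 0, 1), (2, 1, 0), (3, 0, 0)]

/-- Base points. -/
def base : ℕ → ℕ × ℕ × ℕ
  | 0 => (9, 37, 55)
  | 1 => (52, 49, 5)
  | 2 => (17, 8, 32)
  | _ => (49, 29, 31)

/-- Descending factorial. -/
def df (x k : ℕ) : ℕ :=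
  Nat.rec (motive := fun _ => ℕ) 1 (fun n ih => Nat.mul (Nat.sub x n) ih) k

/-- Entry of the interpolation matrix. -/
def entry (b : ℕ × ℕ × ℕ) (ν : ℕ × ℕ × ℕ) (n : ℕ) : ℕ :=
  Nat.mul (Nat.mul (Nat.mul (df (cx n) ν.1) (df (cy n) ν.2.1)) (df (cz n) ν.2.2))
    (Nat.mul (Nat.mul (Nat.pow b.1 (cx n)) (Nat.pow b.2.1 (cy n))) (Nat.pow b.2.2 (cz n)))

/-- A packed row of the interpolation matrix. -/
def mkRow (b : ℕ × ℕ × ℕ) (ν : ℕ × ℕ × ℕ) (L : List ℕ) : ℕ :=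
  List.rec (motive := fun _ => ℕ) 0
    (fun n _ ih => Nat.add (Nat.mod (entry b ν n) 8191) (Nat.mul 4294967296 ih)) L

/-- All the packed rows. -/
def mkRows (L : List ℕ) (k : List ℕ → Bool) (q : List (ℕ × ℕ × ℕ × ℕ)) : List ℕ → Bool :=
  List.rec (motive := fun _ => List ℕ → Bool) (fun acc => k acc)
    (fun bn _ ih acc => force (mkRow (base bn.1) bn.2 L) fun v => ih (List.cons v acc)) q

/-- The configurations: `s` quadruple points and `4 - 2 s` triple points. -/
def conf : ℕ → List (ℕ × ℕ × ℕ × ℕ)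
  | 0 => [0, 1, 2, 3].flatMap fun b => (nus3).map fun ν => (b, ν)
  | 1 => (nus4).map (fun ν => (0, ν)) ++ [2, 3].flatMap fun b => (nus3).map fun ν => (b, ν)
  | _ => [0, 1].flatMap fun b => (nus4).map fun ν => (b, ν)

/-- The packed vector of length `n` with all the entries equal to `c`. -/
def mask (c n : ℕ) : ℕ :=
  Nat.rec (motive := fun _ => ℕ) 0 (fun _ ih => Nat.add c (Nat.mul 4294967296 ih)) n

def cellOK (s : ℕ) (L : List ℕ) : Bool :=
  mkRows L (fun rows => elim L.length (mask 8191 L.length) (mask 524287 L.length) rows)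
    (conf s) []

theorem force_eq {α : Type} (x : ℕ) (k : ℕ → α) : force x k = k x := by
  cases x <;> rfl

/-- Pairing of a vector with a packed row. -/
def dotN : List (ZMod 8191) → ℕ → ZMod 8191
  | [], _ => 0
  | a :: e, R => a * ((R % 4294967296 : ℕ) : ZMod 8191) + dotN e (R / 4294967296)

/-- The first `n` slots are small. -/
def smallSlots : ℕ → ℕ → Prop
  | 0, _ => True
  | n + 1, R => R % 4294967296 < 16384 ∧ smallSlots n (R / 4294967296)

/-- The pair of masks used in `fold`. -/
def isMask : ℕ → ℕ → ℕ → Prop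
  | 0, _, _ => True
  | n + 1, M, M2 => M % 4294967296 = 8191 ∧ M2 % 4294967296 = 524287 ∧
      isMask n (M / 4294967296) (M2 / 4294967296)

theorem land_mod_slot (a b : ℕ) :
    (a &&& b) % 4294967296 = (a % 4294967296) &&& (b % 4294967296) :=
  Nat.and_mod_two_pow (n := 32)

theorem land_div_slot (a b : ℕ) :
    (a &&& b) / 4294967296 = (a / 4294967296) &&& (b / 4294967296) :=
  Nat.and_div_two_pow (n := 32)

theorem fold_spec (M M2 X : ℕ) (h1 : M % 4294967296 = 8191) (h2 : M2 % 4294967296 = 524287) :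
    fold M M2 X % 4294967296 = X % 4294967296 % 8192 + X % 4294967296 / 8192 ∧
    fold M M2 X / 4294967296 =
      fold (M / 4294967296) (M2 / 4294967296) (X / 4294967296) := by
  have e : fold M M2 X = (X &&& M) + ((X / 8192) &&& M2) := rfl
  have e' : fold (M / 4294967296) (M2 / 4294967296) (X / 4294967296) =
    ((X / 4294967296) &&& (M / 4294967296)) +
      ((X / 4294967296 / 8192) &&& (M2 / 4294967296)) := rfl
  have a1 := land_mod_slot X M
  have a2 := land_mod_slot (X / 8192) M2
  have a3 := land_div_slot X M
  have a4 := land_div_slot (X / 8192) M2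
  rw [h1] at a1
  rw [h2] at a2
  have b1 : X % 4294967296 &&& 8191 = X % 4294967296 % 8192 :=
    Nat.and_two_pow_sub_one_eq_mod _ 13
  have b2 : X / 8192 % 4294967296 &&& 524287 = X / 8192 % 4294967296 % 524288 :=
    Nat.and_two_pow_sub_one_eq_mod _ 19
  have b3 : X / 8192 / 4294967296 = X / 4294967296 / 8192 := by
    rw [Nat.div_div_eq_div_mul, Nat.div_div_eq_div_mul]
  have b4 : X / 8192 % 4294967296 % 524288 = X % 4294967296 / 8192 := by
    rw [Nat.mod_mod_of_dvd _ (by norm_num)]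
    exact (Nat.mod_mul_right_div_self X 8192 524288).symm
  rw [b1] at a1
  rw [b2, b4] at a2
  clear b1 b2 b4
  rw [b3] at a4
  rw [e, e', ← a3, ← a4]
  clear a3 a4 b3 e e'
  generalize (X &&& M) = u at *
  generalize (X / 8192 &&& M2) = v at *
  constructor <;> omega

theorem comb_spec (h m O R : ℕ) (hh : h ≤ 8191) (hm : m ≤ 8191) (hO : O % 4294967296 < 16384)
    (hR : R % 4294967296 < 16384) :
    (h * O + m * R) % 4294967296 = h * (O % 4294967296) + m * (R % 4294967296) ∧
    (h * O + m * R) / 4294967296 = h * (O / 4294967296) + m * (R / 4294967296) := by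
  have h1 : h * (O % 4294967296) ≤ 8191 * 16384 := Nat.mul_le_mul hh hO.le
  have h2 : m * (R % 4294967296) ≤ 8191 * 16384 := Nat.mul_le_mul hm hR.le
  have e : h * O + m * R = (h * (O % 4294967296) + m * (R % 4294967296)) +
      4294967296 * (h * (O / 4294967296) + m * (R / 4294967296)) := by
    conv_lhs => rw [← Nat.mod_add_div O 4294967296, ← Nat.mod_add_div R 4294967296]
    ring
  rw [e]
  generalize h * (O % 4294967296) = x at *
  generalize m * (R % 4294967296) = y at *
  generalize (h * (O / 4294967296) + m * (R / 4294967296)) = z at *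
  constructor <;> omega

/-- One elimination step on a row. -/
def step (M M2 h m O R : ℕ) : ℕ := fold M M2 (fold M M2 (h * O + m * R))

theorem cast_fold (x : ℕ) : ((x % 8192 + x / 8192 : ℕ) : ZMod 8191) = x := by
  conv_rhs => rw [← Nat.mod_add_div x 8192]
  push_cast
  have : (8192 : ZMod 8191) = 1 := by
    have : ((8191 : ℕ) : ZMod 8191) = 0 := ZMod.natCast_self _
    have e : (8192 : ZMod 8191) = ((8191 : ℕ) : ZMod 8191) + 1 := by norm_num
    rw [e, this, zero_add]
  rw [this, one_mul]

theorem step_spec (M M2 h m O R : ℕ) (h1 : M % 4294967296 = 8191)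
    (h2 : M2 % 4294967296 = 524287) (hh : h ≤ 8191) (hm : m ≤ 8191)
    (hO : O % 4294967296 < 16384) (hR : R % 4294967296 < 16384) :
    step M M2 h m O R % 4294967296 < 16384 ∧
    ((step M M2 h m O R % 4294967296 : ℕ) : ZMod 8191) =
      h * ((O % 4294967296 : ℕ) : ZMod 8191) + m * ((R % 4294967296 : ℕ) : ZMod 8191) ∧
    step M M2 h m O R / 4294967296 =
      step (M / 4294967296) (M2 / 4294967296) h m (O / 4294967296) (R / 4294967296) := by
  obtain ⟨c1, c2⟩ := comb_spec h m O R hh hm hO hR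
  obtain ⟨f1, f2⟩ := fold_spec M M2 (h * O + m * R) h1 h2
  obtain ⟨g1, g2⟩ := fold_spec M M2 (fold M M2 (h * O + m * R)) h1 h2
  have e1 : h * (O % 4294967296) ≤ 8191 * 16384 := Nat.mul_le_mul hh hO.le
  have e2 : m * (R % 4294967296) ≤ 8191 * 16384 := Nat.mul_le_mul hm hR.le
  refine ⟨?_, ?_, ?_⟩
  · unfold step
    rw [g1, f1, c1]
    omega
  · unfold step
    rw [g1, f1, c1, cast_fold, cast_fold]
    push_cast
    rfl
  · unfold step
    rw [g2, f2, c2]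

theorem step_vec (h m : ℕ) (hh : h ≤ 8191) (hm : m ≤ 8191) (e : List (ZMod 8191)) :
    ∀ M M2 O R : ℕ, isMask e.length M M2 → smallSlots e.length O → smallSlots e.length R →
      smallSlots e.length (step M M2 h m O R) ∧
      dotN e (step M M2 h m O R) = h * dotN e O + m * dotN e R := by
  induction e with
  | nil => intro M M2 O R _ _ _; simp [smallSlots, dotN]
  | cons a e ih =>
    rintro M M2 O R ⟨h1, h2, h3⟩ ⟨o1, o2⟩ ⟨r1, r2⟩
    obtain ⟨s1, s2, s3⟩ := step_spec M M2 h m O R h1 h2 hh hm o1 r1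
    obtain ⟨i1, i2⟩ := ih _ _ _ _ h3 o2 r2
    refine ⟨⟨s1, ?_⟩, ?_⟩
    · rw [s3]; exact i1
    · simp only [dotN]
      rw [s3, i2, s2]
      ring

theorem elimRows_spec (M M2 h r : ℕ) (k : List ℕ → Bool) (rows : List ℕ) :
    ∀ acc, elimRows M M2 h r k rows acc =
      k ((rows.map fun o => step M M2 h (8191 - o % 4294967296 % 8191)
        (o / 4294967296) r).reverse ++ acc) := by
  induction rows with
  | nil => intro acc; rfl
  | cons o rows ih =>
    intro acc
    have : elimRows M M2 h r k (o :: rows) acc =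
      force (step M M2 h (8191 - o % 4294967296 % 8191) (o / 4294967296) r)
        fun v => elimRows M M2 h r k rows (v :: acc) := rfl
    rw [this, force_eq, ih]
    simp

theorem pivot_spec (P : ℕ → Prop) (k : ℕ → ℕ → List ℕ → Bool) (rows : List ℕ) :
    ∀ acc, (∀ x ∈ rows, P x) → (∀ x ∈ acc, P x) → pivot k rows acc = true →
      ∃ o rest, P o ∧ (∀ x ∈ rest, P x) ∧ o % 4294967296 % 8191 ≠ 0 ∧
        k (o % 4294967296 % 8191) (o / 4294967296) rest = true := by
  induction rows with
  | nil =>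
    intro acc _ _ h
    exact absurd h (by simp [pivot])
  | cons o rows ih =>
    intro acc h1 h2 h
    have e : pivot k (o :: rows) acc =
      Nat.rec (motive := fun _ => Bool) (pivot k rows (o :: acc))
        (fun h _ => k (Nat.succ h) (o / 4294967296) (acc ++ rows))
        (o % 4294967296 % 8191) := rfl
    rw [e] at h
    have ho := h1 o (by simp)
    have hr : ∀ x ∈ rows, P x := fun x hx => h1 x (by simp [hx])
    rcases hv : o % 4294967296 % 8191 with _ | v
    · rw [hv] at h
      exact ih (o :: acc) hr (by
        intro x hx
        rcases List.mem_cons.1 hx with rfl | hx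
        · exact ho
        · exact h2 x hx) h
    · rw [hv] at h
      refine ⟨o, acc ++ rows, ho, ?_, by omega, by rw [hv]; exact h⟩
      intro x hx
      rcases List.mem_append.1 hx with hx | hx
      · exact h2 x hx
      · exact hr x hx

instance fact_prime : Fact (Nat.Prime 8191) := ⟨by norm_num⟩

theorem elim_sound (e : List (ZMod 8191)) :
    ∀ M M2 rows, isMask e.length M M2 →
      (∀ R ∈ rows, smallSlots e.length R ∧ dotN e R = 0) →
      elim e.length M M2 rows = true → ∀ a ∈ e, a = 0 := by
  induction e with
  | nil => intro M M2 rows _ _ _ a ha; simp at ha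
  | cons a e ih =>
    rintro M M2 rows ⟨hm1, hm2, hm3⟩ hrows hel
    have e1 : elim (a :: e).length M M2 rows =
      force (M / 4294967296) fun M => force (M2 / 4294967296) fun M2 =>
        pivot (fun h r rest => force r fun r =>
          elimRows M M2 h r (fun l => elim e.length M M2 l) rest []) rows [] := rfl
    rw [e1] at hel
    simp only [force_eq] at hel
    obtain ⟨o, rest, ⟨⟨ho1, ho2⟩, ho3⟩, hrest, hne, hk⟩ :=
      pivot_spec _ _ rows [] hrows (by simp) hel
    rw [elimRows_spec] at hk
    have key : ∀ x ∈ e, x = 0 := by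
      refine ih _ _ _ hm3 ?_ hk
      intro R hR
      simp only [List.append_nil, List.mem_reverse, List.mem_map] at hR
      obtain ⟨q, hq, rfl⟩ := hR
      obtain ⟨⟨q1, q2⟩, q3⟩ := hrest q hq
      obtain ⟨s1, s2⟩ := step_vec (o % 4294967296 % 8191) (8191 - q % 4294967296 % 8191)
        (by omega) (by omega) e _ _ _ _ hm3 q2 ho2
      refine ⟨s1, ?_⟩
      rw [s2]
      simp only [dotN] at ho3 q3
      have c1 : ((o % 4294967296 % 8191 : ℕ) : ZMod 8191) = ((o % 4294967296 : ℕ) : ZMod 8191) :=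
        ZMod.natCast_mod _ _
      have c2 : ((8191 - q % 4294967296 % 8191 : ℕ) : ZMod 8191) =
          - ((q % 4294967296 : ℕ) : ZMod 8191) := by
        rw [Nat.cast_sub (by omega), ZMod.natCast_mod, ZMod.natCast_self, zero_sub]
      rw [c1, c2]
      linear_combination ((o % 4294967296 : ℕ) : ZMod 8191) * q3 -
        ((q % 4294967296 : ℕ) : ZMod 8191) * ho3
    have dz : ∀ (l : List (ZMod 8191)), (∀ x ∈ l, x = 0) → ∀ R, dotN l R = 0 := by
      intro l
      induction l with
      | nil => intro _ R; rfl
      | cons b l ihl =>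
        intro hl R
        simp only [dotN]
        rw [hl b (by simp), ihl (fun x hx => hl x (by simp [hx]))]
        ring
    have ha : a = 0 := by
      simp only [dotN] at ho3
      rw [dz e key, add_zero] at ho3
      rcases mul_eq_zero.1 ho3 with h | h
      · exact h
      · exfalso
        apply hne
        rw [ZMod.natCast_eq_zero_iff] at h
        exact Nat.mod_eq_zero_of_dvd h
    intro x hx
    rcases List.mem_cons.1 hx with rfl | hx
    · exact ha
    · exact key x hx

theorem mask_spec (n : ℕ) : isMask n (mask 8191 n) (mask 524287 n) := by
  induction n with
  | zero => trivial
  | succ n ih =>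
    have e1 : mask 8191 (n + 1) = 8191 + 4294967296 * mask 8191 n := rfl
    have e2 : mask 524287 (n + 1) = 524287 + 4294967296 * mask 524287 n := rfl
    refine ⟨by omega, by omega, ?_⟩
    have e3 : mask 8191 (n + 1) / 4294967296 = mask 8191 n := by omega
    have e4 : mask 524287 (n + 1) / 4294967296 = mask 524287 n := by omega
    rw [e3, e4]
    exact ih

theorem mkRow_spec (b ν : ℕ × ℕ × ℕ) (e : ℕ → ZMod 8191) (L : List ℕ) :
    smallSlots L.length (mkRow b ν L) ∧
      dotN (L.map e) (mkRow b ν L) = (L.map fun n => e n * (entry b ν n : ZMod 8191)).sum := by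
  induction L with
  | nil => exact ⟨trivial, rfl⟩
  | cons n L ih =>
    have e1 : mkRow b ν (n :: L) = entry b ν n % 8191 + 4294967296 * mkRow b ν L := rfl
    have e2 : mkRow b ν (n :: L) % 4294967296 = entry b ν n % 8191 := by omega
    have e3 : mkRow b ν (n :: L) / 4294967296 = mkRow b ν L := by omega
    refine ⟨⟨by omega, by rw [e3]; exact ih.1⟩, ?_⟩
    simp only [List.map_cons, dotN, List.sum_cons]
    rw [e2, e3, ih.2, ZMod.natCast_mod]

theorem mkRows_spec (L : List ℕ) (k : List ℕ → Bool) (q : List (ℕ × ℕ × ℕ × ℕ)) :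
    ∀ acc, mkRows L k q acc =
      k ((q.map fun bn => mkRow (base bn.1) bn.2 L).reverse ++ acc) := by
  induction q with
  | nil => intro acc; rfl
  | cons o q ih =>
    intro acc
    have : mkRows L k (o :: q) acc =
      force (mkRow (base o.1) o.2 L) fun v => mkRows L k q (v :: acc) := rfl
    rw [this, force_eq, ih]
    simp

theorem cell_sound (s : ℕ) (L : List ℕ) (hL : cellOK s L = true) (e : ℕ → ZMod 8191)
    (he : ∀ bn ∈ conf s,
      (L.map fun n => e n * (entry (base bn.1) bn.2 n : ZMod 8191)).sum = 0) :
    ∀ n ∈ L, e n = 0 := by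
  unfold cellOK at hL
  rw [mkRows_spec] at hL
  have hlen : (L.map e).length = L.length := by simp
  have := elim_sound (L.map e) (mask 8191 L.length) (mask 524287 L.length)
    ((conf s).map fun bn => mkRow (base bn.1) bn.2 L).reverse
    (by rw [hlen]; exact mask_spec _)
    (by
      intro R hR
      simp only [List.mem_reverse, List.mem_map] at hR
      obtain ⟨bn, hbn, rfl⟩ := hR
      obtain ⟨m1, m2⟩ := mkRow_spec (base bn.1) bn.2 e L
      rw [hlen, m2]
      exact ⟨m1, he bn hbn⟩)
    (by rw [hlen]; simpa using hL)
  intro n hn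
  exact this _ (List.mem_map.2 ⟨n, hn, rfl⟩)

theorem pow_dvd_eq_zero (z : ℤ) (p : ℕ) (hp : 2 ≤ p) (h : ∀ k : ℕ, (p : ℤ) ^ k ∣ z) : z = 0 := by
  by_contra hz
  have h1 := Int.natAbs_dvd_natAbs.2 (h z.natAbs)
  have h2 := Nat.le_of_dvd (Int.natAbs_pos.2 hz) h1
  rw [Int.natAbs_pow, Int.natAbs_natCast] at h2
  exact absurd h2 (not_le.2 (Nat.lt_pow_self (by omega)))

/-- The descent: a degenerate interpolation problem which is uniquely solvable in each cell modulo
`p` is uniquely solvable over the integers. -/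
theorem descent {I : Type} (T : Finset ℕ) (L : I → Finset ℕ) (δ : I → ℕ → ℕ)
    (Q : I → (ℕ → ℕ) → Prop) (hLT : ∀ i, L i ⊆ T) (hcov : ∀ n ∈ T, ∃ i, n ∈ L i)
    (h0 : ∀ i, ∀ n ∈ L i, δ i n = 0) (h1 : ∀ i, ∀ n ∈ T, n ∉ L i → δ i n ≠ 0)
    (huni : ∀ i (e : ℕ → ZMod 8191),
      (∀ q, Q i q → ∑ n ∈ L i, e n * (q n : ZMod 8191) = 0) → ∀ n ∈ L i, e n = 0)
    (e : ℕ → ℤ)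
    (he : ∀ i q, Q i q → ∑ n ∈ T, e n * (q n : ℤ) * (8191 : ℤ) ^ δ i n = 0) :
    ∀ n ∈ T, e n = 0 := by
  have key : ∀ e : ℕ → ℤ,
      (∀ i q, Q i q → ∑ n ∈ T, e n * (q n : ℤ) * (8191 : ℤ) ^ δ i n = 0) →
      ∀ n ∈ T, (8191 : ℤ) ∣ e n := by
    intro e he n hn
    obtain ⟨i, hi⟩ := hcov n hn
    have := huni i (fun n => (e n : ZMod 8191)) (by
      intro q hq
      have hs := congrArg (Int.cast : ℤ → ZMod 8191) (he i q hq)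
      push_cast at hs
      rw [← Finset.sum_subset (hLT i)] at hs
      · rw [← hs]
        refine Finset.sum_congr rfl fun m hm => ?_
        rw [h0 i m hm]
        simp
      · intro m hm hm'
        have : (8191 : ZMod 8191) = 0 := ZMod.natCast_self 8191
        rw [this, zero_pow (h1 i m hm hm'), mul_zero]) n hi
    exact (ZMod.intCast_zmod_eq_zero_iff_dvd (e n) 8191).1 this
  have all : ∀ k : ℕ, ∀ e : ℕ → ℤ,
      (∀ i q, Q i q → ∑ n ∈ T, e n * (q n : ℤ) * (8191 : ℤ) ^ δ i n = 0) →
      ∀ n ∈ T, ((8191 : ℕ) : ℤ) ^ k ∣ e n := by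
    intro k
    induction k with
    | zero => intro e _ n _; simp
    | succ k ih =>
      intro e he n hn
      have hd := key e he
      have := ih (fun n => e n / 8191) (by
        intro i q hq
        have h := he i q hq
        have : (8191 : ℤ) * ∑ n ∈ T, e n / 8191 * (q n : ℤ) * (8191 : ℤ) ^ δ i n = 0 := by
          rw [← h, Finset.mul_sum]
          refine Finset.sum_congr rfl fun m hm => ?_
          conv_rhs => rw [← Int.mul_ediv_cancel' (hd m hm)]
          ring
        simpa using this) n hn
      have h2 := mul_dvd_mul_left (8191 : ℤ) this
      rw [Int.mul_ediv_cancel' (hd n hn)] at h2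
      rw [pow_succ']
      exact h2
  intro n hn
  exact pow_dvd_eq_zero _ 8191 (by norm_num) fun k => all k e he n hn

/-- The rational version of `descent`. -/
theorem descent_rat {I : Type} (T : Finset ℕ) (L : I → Finset ℕ) (g : I → ℕ → ℕ)
    (Q : I → (ℕ → ℕ) → Prop) (hLT : ∀ i, L i ⊆ T) (hcov : ∀ n ∈ T, ∃ i, n ∈ L i)
    (hg : ∀ i, ∀ n ∈ L i, ∀ j, j ≠ i → g i n < g j n)
    (huni : ∀ i (e : ℕ → ZMod 8191),
      (∀ q, Q i q → ∑ n ∈ L i, e n * (q n : ZMod 8191) = 0) → ∀ n ∈ L i, e n = 0)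
    (c : ℕ → ℚ)
    (hc : ∀ i q, Q i q → ∑ n ∈ T, c n * (q n : ℚ) * (8191 : ℚ) ^ g i n = 0) :
    ∀ n ∈ T, c n = 0 := by
  have hφ : ∀ n, ∃ φ : ℕ, n ∈ T → ∀ i, (n ∈ L i → g i n = φ) ∧ (n ∉ L i → φ < g i n) := by
    intro n
    by_cases hn : n ∈ T
    · obtain ⟨j, hj⟩ := hcov n hn
      refine ⟨g j n, fun _ i => ⟨fun hi => ?_, fun hi => hg j n hj i ?_⟩⟩
      · by_contra hne
        have hij : j ≠ i := fun h => hne (by rw [h])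
        have a := hg j n hj i hij.symm
        have b := hg i n hi j hij
        omega
      · rintro rfl
        exact hi hj
    · exact ⟨0, fun h => absurd h hn⟩
  choose φ hφ using hφ
  obtain ⟨b, hb⟩ := IsLocalization.exist_integer_multiples (nonZeroDivisors ℤ) T
    (fun n => c n * (8191 : ℚ) ^ φ n)
  have hz : ∀ n, ∃ z : ℤ, n ∈ T → (z : ℚ) = ((b : ℤ) : ℚ) * (c n * (8191 : ℚ) ^ φ n) := by
    intro n
    by_cases hn : n ∈ T
    · obtain ⟨z, hz⟩ := hb n hn
      refine ⟨z, fun _ => ?_⟩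
      simpa using hz
    · exact ⟨0, fun h => absurd h hn⟩
  choose e he using hz
  have hb0 : ((b : ℤ) : ℚ) ≠ 0 := by
    exact_mod_cast nonZeroDivisors.coe_ne_zero b
  have := descent T L (fun i n => g i n - φ n) Q hLT hcov
    (by intro i n hn; rw [((hφ n (hLT i hn)) i).1 hn]; simp)
    (by
      intro i n hn hn'
      have := ((hφ n hn) i).2 hn'
      omega) huni e (by
      intro i q hq
      have h := hc i q hq
      have : ((∑ n ∈ T, e n * (q n : ℤ) * (8191 : ℤ) ^ (g i n - φ n) : ℤ) : ℚ) = 0 := by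
        push_cast
        rw [← mul_zero ((b : ℤ) : ℚ), ← h, Finset.mul_sum]
        refine Finset.sum_congr rfl fun n hn => ?_
        rw [he n hn]
        have hle : φ n ≤ g i n := by
          by_cases hi : n ∈ L i
          · rw [((hφ n hn) i).1 hi]
          · exact (((hφ n hn) i).2 hi).le
        have : (8191 : ℚ) ^ g i n = (8191 : ℚ) ^ φ n * (8191 : ℚ) ^ (g i n - φ n) := by
          rw [← pow_add]
          congr 1
          omega
        rw [this]
        ring
      exact_mod_cast this)
  intro n hn
  have h0 := he n hn
  rw [this n hn] at h0
  have h8 : (8191 : ℚ) ^ φ n ≠ 0 := pow_ne_zero _ (by norm_num)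
  have : c n * (8191 : ℚ) ^ φ n = 0 := by
    rcases mul_eq_zero.1 h0.symm with h | h
    · exact absurd h hb0
    · exact h
  exact (mul_eq_zero.1 this).resolve_right h8

theorem pderiv_pow_monomial (i : Fin 4) (k : ℕ) (u : Fin 4 →₀ ℕ) (c : ℚ) :
    ((pderiv i).toLinearMap ^ k : Module.End ℚ (MvPolynomial (Fin 4) ℚ)) (monomial u c) =
      monomial (u - Finsupp.single i k) (c * ((u i).descFactorial k : ℚ)) := by
  induction k with
  | zero => simp
  | succ k ih =>
    rw [pow_succ', Module.End.mul_apply, ih]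
    change pderiv i (monomial _ _) = _
    rw [pderiv_monomial]
    rw [tsub_tsub, ← Finsupp.single_add]
    congr 1
    simp [Finsupp.tsub_apply, Nat.descFactorial_succ]
    ring

theorem desc_pow (a : ℚ) (x k : ℕ) :
    (x.descFactorial k : ℚ) * a ^ (x - k) * a ^ k = (x.descFactorial k : ℚ) * a ^ x := by
  by_cases h : k ≤ x
  · rw [mul_assoc, ← pow_add, Nat.sub_add_cancel h]
  · rw [Nat.descFactorial_eq_zero_iff_lt.2 (by omega)]
    simp

/-- The exponent vector with code `n`. -/
noncomputable def expo (n : ℕ) : Fin 4 →₀ ℕ :=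
  Finsupp.equivFunOnFinite.symm ![14 - (cx n + cy n + cz n), cx n, cy n, cz n]

/-- The set of codes. -/
def codes : Finset ℕ := (Finset.range 3375).filter fun n => cx n + cy n + cz n ≤ 14

theorem expo_inj {n m : ℕ} (h : expo n = expo m) : n = m := by
  have h1 : cx n = cx m := by simpa [expo] using DFunLike.congr_fun h 1
  have h2 : cy n = cy m := by simpa [expo] using DFunLike.congr_fun h 2
  have h3 : cz n = cz m := by simpa [expo] using DFunLike.congr_fun h 3
  change n % 15 = m % 15 at h1
  change n / 15 % 15 = m / 15 % 15 at h2
  change n / 225 = m / 225 at h3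
  omega

theorem homog_expand (f : MvPolynomial (Fin 4) ℚ) (hf : f.IsHomogeneous 14) :
    f = ∑ n ∈ codes, monomial (expo n) (coeff (expo n) f) := by
  ext u
  rw [coeff_sum]
  simp only [coeff_monomial]
  by_cases hu : coeff u f = 0
  · rw [hu, Finset.sum_eq_zero]
    intro n _
    split_ifs with h
    · rw [h, hu]
    · rfl
  · have hd := hf hu
    have hd' : u 0 + u 1 + u 2 + u 3 = 14 := by
      rw [← hd, Finsupp.weight_apply, Finsupp.sum_fintype _ _ (by simp), Fin.sum_univ_four]
      simp
    set n := u 1 + 15 * u 2 + 225 * u 3 with hn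
    have h1 : cx n = u 1 := by change n % 15 = _; omega
    have h2 : cy n = u 2 := by change n / 15 % 15 = _; omega
    have h3 : cz n = u 3 := by change n / 225 = _; omega
    have he : expo n = u := by
      ext j
      fin_cases j
      · simp [expo, h1, h2, h3]; omega
      · simp [expo, h1]
      · simp [expo, h2]
      · simp [expo, h3]
    have hm : n ∈ codes := by
      simp only [codes, Finset.mem_filter, Finset.mem_range]
      rw [h1, h2, h3]
      omega
    rw [Finset.sum_eq_single_of_mem n hm]
    · rw [if_pos he, he]
    · intro m _ hmn
      rw [if_neg]
      intro h
      exact hmn (expo_inj (h.trans he.symm))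

theorem aeval_diffOp (x y z : ℚ) (i j k : ℕ) (n : ℕ) (c : ℚ) :
    aeval (![1, x, y, z] : Fin 4 → ℚ) (diffOp ![0, i, j, k] (monomial (expo n) c)) *
      (x ^ i * y ^ j * z ^ k) =
    c * (((cx n).descFactorial i * (cy n).descFactorial j * (cz n).descFactorial k : ℕ) : ℚ) *
      (x ^ cx n * y ^ cy n * z ^ cz n) := by
  have e : diffOp ![0, i, j, k] (monomial (expo n) c) =
      monomial (expo n - Finsupp.single 3 k - Finsupp.single 2 j - Finsupp.single 1 i)
        (c * ((cz n).descFactorial k : ℚ) * ((cy n).descFactorial j : ℚ) *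
          ((cx n).descFactorial i : ℚ)) := by
    simp only [diffOp, Module.End.mul_apply]
    simp only [pderiv_pow_monomial]
    simp [expo, Finsupp.tsub_apply, Finsupp.single_apply]
  rw [e, aeval_monomial, Finsupp.prod_fintype _ _ (by simp), Fin.prod_univ_four]
  simp [expo, Finsupp.tsub_apply, Finsupp.single_apply]
  linear_combination c * (((cy n).descFactorial j : ℚ) * y ^ (cy n - j) * y ^ j) *
      (((cz n).descFactorial k : ℚ) * z ^ (cz n - k) * z ^ k) * desc_pow x (cx n) i +
    c * (((cx n).descFactorial i : ℚ) * x ^ cx n) *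
      (((cz n).descFactorial k : ℚ) * z ^ (cz n - k) * z ^ k) * desc_pow y (cy n) j +
    c * (((cx n).descFactorial i : ℚ) * x ^ cx n) *
      (((cy n).descFactorial j : ℚ) * y ^ cy n) * desc_pow z (cz n) k

theorem df_eq (x k : ℕ) : df x k = x.descFactorial k := by
  induction k with
  | zero => rfl
  | succ k ih =>
    have : df x (k + 1) = (x - k) * df x k := rfl
    rw [this, ih, Nat.descFactorial_succ]

/-- The point attached to a base point and a weight. -/
def mkPt (b α : ℕ × ℕ × ℕ) : Fin 4 → ℚ :=
  ![1, (b.1 : ℚ) * 8191 ^ α.1, (b.2.1 : ℚ) * 8191 ^ α.2.1, (b.2.2 : ℚ) * 8191 ^ α.2.2]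

theorem vanish_rel (f : MvPolynomial (Fin 4) ℚ) (hf : f.IsHomogeneous 14) (m : ℕ)
    (b α ν : ℕ × ℕ × ℕ) (hν : ν.1 + ν.2.1 + ν.2.2 < m)
    (h : f ∈ vanishingSpace m (mkPt b α)) :
    ∑ n ∈ codes, coeff (expo n) f * (entry b ν n : ℚ) *
      8191 ^ (α.1 * cx n + α.2.1 * cy n + α.2.2 * cz n) = 0 := by
  have h1 : aeval (mkPt b α) (diffOp ![0, ν.1, ν.2.1, ν.2.2] f) = 0 := by
    simp only [vanishingSpace, Submodule.mem_iInf, LinearMap.mem_ker] at h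
    exact h ![0, ν.1, ν.2.1, ν.2.2] (by simp [Fin.sum_univ_four]; omega)
  rw [homog_expand f hf, map_sum, map_sum] at h1
  have h2 := congrArg (fun t : ℚ => t * (((b.1 : ℚ) * 8191 ^ α.1) ^ ν.1 *
    ((b.2.1 : ℚ) * 8191 ^ α.2.1) ^ ν.2.1 * ((b.2.2 : ℚ) * 8191 ^ α.2.2) ^ ν.2.2)) h1
  simp only [Finset.sum_mul, zero_mul] at h2
  rw [← h2]
  refine Finset.sum_congr rfl fun n _ => ?_
  rw [mkPt, aeval_diffOp]
  have : entry b ν n = (df (cx n) ν.1 * df (cy n) ν.2.1 * df (cz n) ν.2.2) *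
    (b.1 ^ cx n * b.2.1 ^ cy n * b.2.2 ^ cz n) := rfl
  rw [this, df_eq, df_eq, df_eq]
  push_cast
  rw [mul_pow, mul_pow, mul_pow, ← pow_mul, ← pow_mul, ← pow_mul, pow_add, pow_add]
  ring

/-- The data of the `i`-th cell. -/
def cellD (i : ℕ) : ℕ × ℕ × ℕ × ℕ × List ℕ := cells.getD i (0, 0, 0, 0, [])

/-- The monomials of the `i`-th cell. -/
def cellL (i : ℕ) : List ℕ := (cellD i).2.2.2.2

/-- The weight of the `i`-th cell. -/
def cellA (i : ℕ) : ℕ × ℕ × ℕ := ((cellD i).2.1, (cellD i).2.2.1, (cellD i).2.2.2.1)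

/-- The affine function attached to the `i`-th cell. -/
def gval (i n : ℕ) : ℕ :=
  (cellD i).1 + ((cellA i).1 * cx n + (cellA i).2.1 * cy n + (cellA i).2.2 * cz n)

set_option maxRecDepth 100000 in
theorem cells_ok : ∀ i < 17, ∀ s < 3, cellOK s (cellL i) = true := by
  intro i hi s hs
  interval_cases i <;> interval_cases s <;> decide +kernel

/-- The affine function of the cell is smallest on the cell. -/
def partOK (i : ℕ) : Bool :=
  (cellL i).all fun n => (decide (n < 3375) && decide (cx n + cy n + cz n ≤ 14)) &&
    (List.range 17).all fun j => decide (j = i) || decide (gval i n < gval j n)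

set_option maxRecDepth 100000 in
theorem part_ok : ∀ i < 17, partOK i = true := by
  intro i hi
  interval_cases i <;> decide +kernel

set_option maxRecDepth 100000 in
theorem nodup_ok : ∀ i < 17, (cellL i).Nodup := by
  intro i hi
  interval_cases i <;> decide +kernel

/-- Every monomial with given last exponent is in some cell. -/
def coverOK (z : ℕ) : Bool :=
  (List.range 15).all fun y => (List.range 15).all fun x => decide (14 < x + y + z) ||
    (List.range 17).any fun i => (cellL i).any fun m => Nat.beq (x + 15 * y + 225 * z) m

set_option maxRecDepth 100000 in
theorem cover_ok : ∀ z < 15, coverOK z = true := by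
  intro z hz
  interval_cases z <;> decide +kernel

set_option maxRecDepth 100000 in
theorem weight_inj : ∀ i < 17, ∀ j < 17, (cellA i).1 = (cellA j).1 → i = j := by
  decide +kernel

theorem base_inj : ∀ i < 4, ∀ j < 4, (base i).1 = (base j).1 → i = j := by
  decide +kernel

theorem base_ndvd (i : ℕ) : ¬ 8191 ∣ (base i).1 := by
  unfold base
  split <;> norm_num

theorem cover_codes (n : ℕ) (hn : n ∈ codes) : ∃ i : Fin 17, n ∈ (cellL i).toFinset := by
  simp only [codes, Finset.mem_filter, Finset.mem_range] at hn
  have e1 : cx n = n % 15 := rfl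
  have e2 : cy n = n / 15 % 15 := rfl
  have e3 : cz n = n / 225 := rfl
  have h := cover_ok (cz n) (by omega)
  simp only [coverOK, List.all_eq_true, List.mem_range, Bool.or_eq_true, decide_eq_true_eq,
    List.any_eq_true] at h
  rcases h (cy n) (by omega) (cx n) (by omega) with h | ⟨i, hi, m, hm, h⟩
  · omega
  · have h' := Nat.eq_of_beq_eq_true h
    refine ⟨⟨i, hi⟩, ?_⟩
    have : n = m := by omega
    rw [this]
    simpa using hm

theorem part_codes (i : Fin 17) (n : ℕ) (hn : n ∈ (cellL i).toFinset) :
    n ∈ codes ∧ ∀ j : Fin 17, j ≠ i → gval i n < gval j n := by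
  have h := part_ok i i.2
  simp only [partOK, List.all_eq_true, List.mem_range, Bool.or_eq_true, decide_eq_true_eq,
    Bool.and_eq_true] at h
  obtain ⟨h1, h2⟩ := h n (by simpa using hn)
  refine ⟨by simpa [codes] using h1, fun j hj => ?_⟩
  rcases h2 j j.2 with h | h
  · exact absurd (Fin.ext h) hj
  · exact h

/-- The number of quadruple points in a cell. -/
def sIdx (a i : ℕ) : ℕ := min 2 (a - 2 * i)

/-- The cell of the `i`-th point. -/
def cIdx (a i : ℕ) : ℕ := if i < a then i / 2 else (i + a) / 4

/-- The base point of the `i`-th point. -/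
def bIdx (a i : ℕ) : ℕ := if i < a then i % 2 else (i + a) % 4

theorem conf0_mem : ∀ bn ∈ conf 0, bn.1 < 4 ∧ bn.2.1 + bn.2.2.1 + bn.2.2.2 < 3 := by
  decide +kernel

theorem conf1_mem : ∀ bn ∈ conf 1, (bn.1 = 0 ∧ bn.2.1 + bn.2.2.1 + bn.2.2.2 < 4) ∨
    ((bn.1 = 2 ∨ bn.1 = 3) ∧ bn.2.1 + bn.2.2.1 + bn.2.2.2 < 3) := by
  decide +kernel

theorem conf2_mem : ∀ bn ∈ conf 2, bn.1 < 2 ∧ bn.2.1 + bn.2.2.1 + bn.2.2.2 < 4 := by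
  decide +kernel

theorem exists_idx (a b : ℕ) (hab : 2 * a + b = 68) (c : ℕ) (hc : c < 17)
    (bn : ℕ × ℕ × ℕ × ℕ) (hbn : bn ∈ conf (sIdx a c)) :
    ∃ i < a + b, cIdx a i = c ∧ bIdx a i = bn.1 ∧
      bn.2.1 + bn.2.2.1 + bn.2.2.2 < (if i < a then 4 else 3) := by
  unfold cIdx bIdx
  rcases (by omega : a ≤ 2 * c ∨ a = 2 * c + 1 ∨ 2 * c + 2 ≤ a) with h | h | h
  · have : sIdx a c = 0 := by unfold sIdx; omega
    rw [this] at hbn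
    obtain ⟨h1, h2⟩ := conf0_mem bn hbn
    have hi : ¬ (4 * c + bn.1 - a < a) := by omega
    refine ⟨4 * c + bn.1 - a, by omega, ?_⟩
    rw [if_neg hi, if_neg hi, if_neg hi]
    omega
  · have : sIdx a c = 1 := by unfold sIdx; omega
    rw [this] at hbn
    rcases conf1_mem bn hbn with ⟨h1, h2⟩ | ⟨h1, h2⟩
    · have hi : 2 * c < a := by omega
      refine ⟨2 * c, by omega, ?_⟩
      rw [if_pos hi, if_pos hi, if_pos hi]
      omega
    · have hi : ¬ (4 * c + bn.1 - a < a) := by omega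
      refine ⟨4 * c + bn.1 - a, by omega, ?_⟩
      rw [if_neg hi, if_neg hi, if_neg hi]
      omega
  · have : sIdx a c = 2 := by unfold sIdx; omega
    rw [this] at hbn
    obtain ⟨h1, h2⟩ := conf2_mem bn hbn
    have hi : 2 * c + bn.1 < a := by omega
    refine ⟨2 * c + bn.1, by omega, ?_⟩
    rw [if_pos hi, if_pos hi, if_pos hi]
    omega

theorem idx_lt (a b : ℕ) (hab : 2 * a + b = 68) (i : ℕ) (hi : i < a + b) :
    cIdx a i < 17 ∧ bIdx a i < 4 := by
  unfold cIdx bIdx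
  split_ifs <;> omega

theorem idx_inj (a b : ℕ) (_hab : 2 * a + b = 68) (i j : ℕ) (hi : i < a + b) (hj : j < a + b)
    (hc : cIdx a i = cIdx a j) (hb : bIdx a i = bIdx a j) : i = j := by
  unfold cIdx at hc
  unfold bIdx at hb
  split_ifs at hc hb <;> omega

theorem mul_pow_inj (β β' x x' : ℕ) (h : ¬ 8191 ∣ β) (h' : ¬ 8191 ∣ β')
    (e : β * 8191 ^ x = β' * 8191 ^ x') : x = x' ∧ β = β' := by
  have aux : ∀ β β' x x' : ℕ, ¬ 8191 ∣ β → β * 8191 ^ x = β' * 8191 ^ x' → x' ≤ x := by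
    intro β β' x x' h e
    by_contra hlt
    obtain ⟨d, rfl⟩ := Nat.exists_eq_add_of_lt (not_le.1 hlt)
    apply h
    have hpos : 0 < 8191 ^ x := by positivity
    refine ⟨β' * 8191 ^ d, Nat.eq_of_mul_eq_mul_right hpos ?_⟩
    rw [e]
    ring
  have hx : x = x' := le_antisymm (aux β' β x' x h' e.symm) (aux β β' x x' h e)
  subst hx
  exact ⟨rfl, Nat.eq_of_mul_eq_mul_right (by positivity) e⟩

theorem mkPt_indep (b α b' α' : ℕ × ℕ × ℕ)
    (h : b.1 * 8191 ^ α.1 ≠ b'.1 * 8191 ^ α'.1) :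
    LinearIndependent ℚ ![mkPt b α, mkPt b' α'] := by
  rw [LinearIndependent.pair_iff]
  intro s t hst
  have h0 := congrFun hst 0
  have h1 := congrFun hst 1
  simp only [mkPt, Pi.add_apply, Pi.smul_apply, smul_eq_mul, Matrix.cons_val_zero,
    Matrix.cons_val_one, Pi.zero_apply, mul_one] at h0 h1
  have ht : t = -s := by linarith
  have hne : (b.1 : ℚ) * 8191 ^ α.1 - (b'.1 : ℚ) * 8191 ^ α'.1 ≠ 0 := by
    rw [sub_ne_zero]
    exact_mod_cast h
  have hs : s * ((b.1 : ℚ) * 8191 ^ α.1 - (b'.1 : ℚ) * 8191 ^ α'.1) = 0 := by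
    rw [ht] at h1
    linear_combination h1
  have : s = 0 := (mul_eq_zero.1 hs).resolve_right hne
  rw [ht, this]
  simp

theorem poly_zero (a b : ℕ) (hab : 2 * a + b = 68) (f : MvPolynomial (Fin 4) ℚ)
    (hf : f.IsHomogeneous 14)
    (h : ∀ i < a + b, f ∈ vanishingSpace (if i < a then 4 else 3)
      (mkPt (base (bIdx a i)) (cellA (cIdx a i)))) : f = 0 := by
  have key := descent_rat (I := Fin 17) codes (fun i => (cellL i).toFinset)
    (fun i n => gval i n)
    (fun i q => ∃ bn ∈ conf (sIdx a i), q = fun n => entry (base bn.1) bn.2 n)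
    (fun i n hn => (part_codes i n hn).1) cover_codes
    (fun i n hn => (part_codes i n hn).2)
    (by
      intro i e he n hn
      refine cell_sound (sIdx a i) (cellL i)
        (cells_ok i i.2 _ (by unfold sIdx; omega)) e ?_ n (by simpa using hn)
      intro bn hbn
      have := he _ ⟨bn, hbn, rfl⟩
      rwa [List.sum_toFinset _ (nodup_ok i i.2)] at this)
    (fun n => coeff (expo n) f)
    (by
      rintro i q ⟨bn, hbn, rfl⟩
      obtain ⟨j, hj, hjc, hjb, hjm⟩ := exists_idx a b hab i i.2 bn hbn
      have hv := h j hj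
      rw [hjc, hjb] at hv
      have hr := vanish_rel f hf _ _ _ bn.2 hjm hv
      have hr' := congrArg (fun t : ℚ => t * 8191 ^ (cellD i).1) hr
      simp only [Finset.sum_mul, zero_mul] at hr'
      rw [← hr']
      refine Finset.sum_congr rfl fun n _ => ?_
      rw [gval, pow_add]
      ring)
  rw [homog_expand f hf]
  refine Finset.sum_eq_zero fun n hn => ?_
  rw [key n hn, map_zero]

theorem vdim_eq (a b : ℕ) (hab : 2 * a + b = 68) :
    vdim 14 (List.replicate a 4 ++ List.replicate b 3) = -1 := by
  have h1 : ((14 + 3).choose 3 : ℤ) = 680 := by decide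
  have h2 : ((4 + 2).choose 3 : ℤ) = 20 := by decide
  have h3 : ((3 + 2).choose 3 : ℤ) = 10 := by decide
  simp only [vdim, List.map_append, List.map_replicate, List.sum_append, List.sum_replicate]
  rw [h1, h2, h3]
  simp only [nsmul_eq_mul]
  have : (2 : ℤ) * a + b = 68 := by exact_mod_cast hab
  linarith

/-- `L_3(14; 4^{×a}, 3^{×b})` with `2a + b = 68` is non-special of virtual dimension `−1`. -/
theorem nonSpecial_fourteen (a b : ℕ) (hab : 2 * a + b = 68) :
    nonSpecial 14 (List.replicate a 4 ++ List.replicate b 3) ∧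
      vdim 14 (List.replicate a 4 ++ List.replicate b 3) = -1 := by
  have hv := vdim_eq a b hab
  refine ⟨?_, hv⟩
  have hlen : (List.replicate a 4 ++ List.replicate b 3).length = a + b := by simp
  refine ⟨fun i => mkPt (base (bIdx a i)) (cellA (cIdx a i)), ?_, ?_, ?_⟩
  · intro i h
    have h0 := congrFun h 0
    simp [mkPt] at h0
  · intro i j hij
    apply mkPt_indep
    intro e
    obtain ⟨e1, e2⟩ := mul_pow_inj _ _ _ _ (base_ndvd _) (base_ndvd _) e
    have hi : (i : ℕ) < a + b := hlen ▸ i.2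
    have hj : (j : ℕ) < a + b := hlen ▸ j.2
    obtain ⟨i1, i2⟩ := idx_lt a b hab i hi
    obtain ⟨j1, j2⟩ := idx_lt a b hab j hj
    exact hij (Fin.ext (idx_inj a b hab i j hi hj (weight_inj _ i1 _ j1 e1)
      (base_inj _ i2 _ j2 e2)))
  · rw [hv]
    have hbot : systemSpace 14 (List.replicate a 4 ++ List.replicate b 3)
        (fun i => mkPt (base (bIdx a i)) (cellA (cIdx a i))) = ⊥ := by
      rw [eq_bot_iff]
      intro f hf
      simp only [systemSpace, Submodule.mem_inf, Submodule.mem_iInf,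
        mem_homogeneousSubmodule] at hf
      obtain ⟨hf1, hf2⟩ := hf
      refine (Submodule.mem_bot ℚ).2 (poly_zero a b hab f hf1 fun i hi => ?_)
      have := hf2 ⟨i, by rw [hlen]; exact hi⟩
      have hm : (List.replicate a 4 ++ List.replicate b 3).get ⟨i, by rw [hlen]; exact hi⟩ =
          if i < a then 4 else 3 := by
        simp [List.getElem_append]
      rw [hm] at this
      exact this
    rw [hbot]
    simp
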